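/- A Banach space X is linearly isomorphic to a Hilbert space (i.e., there exists an inner product on X whose induced norm is equivalent to the norm of X) if and only if there exists a constant K > 0 such that for all m ≥ 1, all X-valued dyadic martingales f^1, …, f^m with f^j_0 = 0, all n ≥ 1, and all 2 ≤ r < ∞, both of the following inequalities hold: (i) ‖(Σ_{j=1}^m ‖f^j_n‖²)^{1/2}‖_{L^r} ≤ K·r^{1/2}·‖(Σ_{j=1}^m S_{2,n}(f^j)²)^{1/2}‖_{L^r}, and (ii) ‖(Σ_{j=1}^m S_{2,n}(f^j)²)^{1/2}‖_{L^r} ≤ K·r^{1/2}·‖(Σ_{j=1}^m ‖f^j_n‖²)^{1/2}‖_{L^r}. -/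

import Mathlib

open MeasureTheory
open scoped ENNReal NNReal


/-- The σ-algebra on `ℝ` generated by the dyadic intervals of length `2^{-n}`. -/
def dyadicAlgebra (n : ℕ) : MeasurableSpace ℝ :=
  MeasurableSpace.generateFrom
    {s | ∃ k : ℤ, s = Set.Ico ((k : ℝ) / 2 ^ n) (((k : ℝ) + 1) / 2 ^ n)}

/-- The dyadic filtration on `ℝ`. -/
noncomputable def dyadicFiltration : Filtration ℕ (Real.measurableSpace) where
  seq := dyadicAlgebra
  mono' := monotone_nat_of_le_succ fun n => by
    refine MeasurableSpace.generateFrom_le ?_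
    rintro s ⟨k, rfl⟩
    have hab : ((2 * k : ℤ) : ℝ) / 2 ^ (n + 1) ≤ ((2 * k + 1 : ℤ) : ℝ) / 2 ^ (n + 1) := by
      gcongr
      push_cast; linarith
    have hbc : ((2 * k + 1 : ℤ) : ℝ) / 2 ^ (n + 1)
        ≤ (((2 * k + 1 : ℤ) : ℝ) + 1) / 2 ^ (n + 1) := by
      gcongr
      linarith
    have e1 : ((2 * k : ℤ) : ℝ) / 2 ^ (n + 1) = (k : ℝ) / 2 ^ n := by
      push_cast; field_simp; ring
    have e2 : (((2 * k + 1 : ℤ) : ℝ) + 1) / 2 ^ (n + 1) = ((k : ℝ) + 1) / 2 ^ n := by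
      push_cast; field_simp; ring
    have e3 : ((2 * k : ℤ) : ℝ) + 1 = ((2 * k + 1 : ℤ) : ℝ) := by push_cast; ring
    have key : Set.Ico ((k : ℝ) / 2 ^ n) (((k : ℝ) + 1) / 2 ^ n)
        = Set.Ico (((2 * k : ℤ) : ℝ) / 2 ^ (n + 1)) ((((2 * k : ℤ) : ℝ) + 1) / 2 ^ (n + 1))
        ∪ Set.Ico (((2 * k + 1 : ℤ) : ℝ) / 2 ^ (n + 1))
            ((((2 * k + 1 : ℤ) : ℝ) + 1) / 2 ^ (n + 1)) := by
      rw [e3, Set.Ico_union_Ico_eq_Ico hab hbc, e1, e2]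
    rw [key]
    exact MeasurableSet.union
      (MeasurableSpace.measurableSet_generateFrom (by exact ⟨2 * k, rfl⟩))
      (MeasurableSpace.measurableSet_generateFrom (by exact ⟨2 * k + 1, rfl⟩))
  le' := fun n => MeasurableSpace.generateFrom_le (by rintro s ⟨k, rfl⟩; exact measurableSet_Ico)


/-- `g` is constant on the dyadic intervals of length `2^{-l}`. -/
def DyConst {Y : Type*} (l : ℕ) (g : ℝ → Y) : Prop :=
  ∀ ω ω' : ℝ, ⌊(2:ℝ) ^ l * ω⌋ = ⌊(2:ℝ) ^ l * ω'⌋ → g ω = g ω'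

lemma floor_half (l : ℕ) (ω : ℝ) : ⌊(2:ℝ) ^ l * ω⌋ = ⌊(2:ℝ) ^ (l + 1) * ω⌋ / 2 := by
  have h := Int.floor_div_natCast ((2:ℝ) ^ (l + 1) * ω) 2
  rw [show ((2:ℝ) ^ (l + 1) * ω) / ((2:ℕ):ℝ) = (2:ℝ) ^ l * ω by push_cast; rw [pow_succ]; ring] at h
  exact_mod_cast h

lemma DyConst.succ {Y : Type*} {l : ℕ} {g : ℝ → Y} (h : DyConst l g) : DyConst (l + 1) g := by
  intro ω ω' e
  apply h
  rw [floor_half l ω, floor_half l ω', e]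

lemma DyConst.mono {Y : Type*} {l m : ℕ} {g : ℝ → Y} (h : DyConst l g) (hlm : l ≤ m) :
    DyConst m g := by
  induction m, hlm using Nat.le_induction with
  | base => exact h
  | succ n _ ih => exact ih.succ

lemma mem_dyInt (l : ℕ) (k : ℤ) (ω : ℝ) :
    ω ∈ Set.Ico ((k : ℝ) / 2 ^ l) (((k : ℝ) + 1) / 2 ^ l) ↔ ⌊(2:ℝ) ^ l * ω⌋ = k := by
  have h2 : (0:ℝ) < 2 ^ l := by positivity
  rw [Int.floor_eq_iff, Set.mem_Ico, div_le_iff₀ h2, lt_div_iff₀ h2, mul_comm]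

lemma dyadicAlgebra_eq (l : ℕ) :
    dyadicAlgebra l = MeasurableSpace.comap (fun ω : ℝ => ⌊(2:ℝ) ^ l * ω⌋) ⊤ := by
  apply le_antisymm
  · refine MeasurableSpace.generateFrom_le ?_
    rintro s ⟨k, rfl⟩
    refine ⟨{k}, trivial, ?_⟩
    ext ω
    rw [mem_dyInt]; simp
  · rintro s ⟨T, -, rfl⟩
    have : (fun ω : ℝ => ⌊(2:ℝ) ^ l * ω⌋) ⁻¹' T =
        ⋃ k ∈ T, Set.Ico ((k : ℝ) / 2 ^ l) (((k : ℝ) + 1) / 2 ^ l) := by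
      ext ω
      simp only [Set.mem_preimage, Set.mem_iUnion, mem_dyInt, exists_prop, exists_eq_right']
    rw [this]
    exact MeasurableSet.biUnion (Set.to_countable T)
      (fun k _ => MeasurableSpace.measurableSet_generateFrom ⟨k, rfl⟩)

lemma dyConst_of_sm {Y : Type*} [TopologicalSpace Y] [TopologicalSpace.PseudoMetrizableSpace Y] [T1Space Y]
    {l : ℕ} {g : ℝ → Y} (h : StronglyMeasurable[dyadicFiltration l] g) : DyConst l g := by
  have h' : StronglyMeasurable[dyadicAlgebra l] g := h
  rw [dyadicAlgebra_eq] at h'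
  intro ω ω' e
  exact h'.factorsThrough e

lemma sm_of_dyConst {Y : Type*} [TopologicalSpace Y] [TopologicalSpace.PseudoMetrizableSpace Y]
    {l : ℕ} {g : ℝ → Y} (h : DyConst l g) : StronglyMeasurable[dyadicFiltration l] g := by
  change StronglyMeasurable[dyadicAlgebra l] g
  rw [dyadicAlgebra_eq]
  have e : g = (fun k : ℤ => g ((k : ℝ) / 2 ^ l)) ∘ (fun ω : ℝ => ⌊(2:ℝ) ^ l * ω⌋) := by
    ext ω
    apply h
    simp only
    rw [mul_div_cancel₀ _ (by positivity)]
    simp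
  rw [e]
  have h1 : StronglyMeasurable[⊤] (fun k : ℤ => g ((k : ℝ) / 2 ^ l)) :=
    StronglyMeasurable.of_discrete
  exact h1.comp_measurable (comap_measurable _)

lemma dy_integral {Y : Type*} [NormedAddCommGroup Y] [NormedSpace ℝ Y] [CompleteSpace Y] {l : ℕ} {g : ℝ → Y}
    (h : DyConst l g) :
    Integrable g (volume.restrict (Set.Icc (0:ℝ) 1)) ∧
    ∫ ω, g ω ∂(volume.restrict (Set.Icc (0:ℝ) 1)) =
      ((2:ℝ) ^ l)⁻¹ • ∑ k ∈ Finset.range (2 ^ l), g ((k : ℝ) / 2 ^ l) := by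
  have h2 : (0:ℝ) < 2 ^ l := by positivity
  rw [← restrict_Ico_eq_restrict_Icc]
  have hae : g =ᵐ[volume.restrict (Set.Ico (0:ℝ) 1)] fun ω => ∑ k ∈ Finset.range (2 ^ l),
      (Set.Ico ((k : ℝ) / 2 ^ l) (((k : ℝ) + 1) / 2 ^ l)).indicator
        (fun _ => g ((k : ℝ) / 2 ^ l)) ω := by
    filter_upwards [ae_restrict_mem measurableSet_Ico] with ω hω
    have h0 : 0 ≤ ⌊(2:ℝ) ^ l * ω⌋ := Int.floor_nonneg.2 (mul_nonneg h2.le hω.1)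
    obtain ⟨k, hk⟩ := Int.eq_ofNat_of_zero_le h0
    have hk2 : k < 2 ^ l := by
      have : ⌊(2:ℝ) ^ l * ω⌋ < ((2 ^ l : ℕ) : ℤ) := by
        rw [Int.floor_lt]; push_cast
        nlinarith [hω.2]
      rw [hk] at this
      exact_mod_cast this
    rw [Finset.sum_eq_single k]
    · rw [Set.indicator_of_mem]
      · apply h
        rw [mul_div_cancel₀ _ h2.ne', hk]; simp
      · have := (mem_dyInt l k ω).2 hk
        simpa using this
    · intro k' _ hne
      rw [Set.indicator_of_notMem]
      intro hm
      have := (mem_dyInt l k' ω).1 (by simpa using hm)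
      rw [hk] at this
      exact hne (by exact_mod_cast this.symm)
    · intro hn; exact absurd (Finset.mem_range.2 hk2) hn
  have hsub : ∀ k ∈ Finset.range (2 ^ l),
      Set.Ico ((k : ℝ) / 2 ^ l) (((k : ℝ) + 1) / 2 ^ l) ∩ Set.Ico (0:ℝ) 1 =
      Set.Ico ((k : ℝ) / 2 ^ l) (((k : ℝ) + 1) / 2 ^ l) := by
    intro k hk
    rw [Set.inter_eq_left]
    apply Set.Ico_subset_Ico
    · positivity
    · rw [div_le_one h2]
      have := Finset.mem_range.1 hk
      exact_mod_cast this
  have hint : ∀ k ∈ Finset.range (2 ^ l), Integrable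
      ((Set.Ico ((k : ℝ) / 2 ^ l) (((k : ℝ) + 1) / 2 ^ l)).indicator
        (fun _ => g ((k : ℝ) / 2 ^ l))) (volume.restrict (Set.Ico (0:ℝ) 1)) := by
    intro k _
    exact (integrable_const _).indicator measurableSet_Ico
  refine ⟨(integrable_finsetSum _ hint).congr ?_, ?_⟩
  · filter_upwards [hae] with ω hω
    rw [hω]
  rw [integral_congr_ae hae, integral_finsetSum _ hint, Finset.smul_sum]
  refine Finset.sum_congr rfl fun k hk => ?_
  rw [integral_indicator_const _ measurableSet_Ico, measureReal_restrict_apply measurableSet_Ico,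
    hsub k hk]
  congr 1
  rw [Real.volume_real_Ico_of_le (by gcongr; linarith)]
  field_simp
  ring

lemma sum_range_double {Y : Type*} [AddCommMonoid Y] (F : ℕ → Y) (N : ℕ) :
    ∑ k ∈ Finset.range (2 * N), F k = ∑ k ∈ Finset.range N, (F (2 * k) + F (2 * k + 1)) := by
  induction N with
  | zero => simp
  | succ n ih =>
    rw [show 2 * (n + 1) = 2 * n + 1 + 1 by ring, Finset.sum_range_succ, Finset.sum_range_succ, ih,
      Finset.sum_range_succ, add_assoc]

lemma dy_integral_succ {Y : Type*} [NormedAddCommGroup Y] [NormedSpace ℝ Y] [CompleteSpace Y]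
    {l : ℕ} {g : ℝ → Y} (h : DyConst (l + 1) g) :
    ∫ ω, g ω ∂(volume.restrict (Set.Icc (0:ℝ) 1)) =
      ((2:ℝ) ^ l)⁻¹ • ∑ k ∈ Finset.range (2 ^ l), (2:ℝ)⁻¹ •
        (g ((k : ℝ) / 2 ^ l) + g ((2 * (k : ℝ) + 1) / 2 ^ (l + 1))) := by
  rw [(dy_integral h).2, ← Finset.smul_sum, smul_smul, show 2 ^ (l + 1) = 2 * 2 ^ l by ring,
    sum_range_double]
  congr 1
  · rw [pow_succ, mul_inv]
  · refine Finset.sum_congr rfl fun k _ => ?_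
    congr 2
    · push_cast
      rw [pow_succ]
      field_simp
    · push_cast
      rfl

lemma floor_pt (l k : ℕ) : ⌊(2:ℝ) ^ l * ((k : ℝ) / 2 ^ l)⌋ = k := by
  rw [mul_div_cancel₀ _ (by positivity)]
  simp

lemma floor_pt' (l k : ℕ) : ⌊(2:ℝ) ^ l * ((2 * (k : ℝ) + 1) / 2 ^ (l + 1))⌋ = k := by
  have : (2:ℝ) ^ l * ((2 * (k : ℝ) + 1) / 2 ^ (l + 1)) = k + 1 / 2 := by
    rw [pow_succ]; field_simp
  rw [this, Int.floor_eq_iff]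
  push_cast
  constructor <;> linarith

lemma DyConst.indicator' {Y : Type*} [Zero Y] {l : ℕ} {g : ℝ → Y} (h : DyConst (l + 1) g)
    (T : Set ℤ) :
    DyConst (l + 1) (Set.indicator ((fun ω : ℝ => ⌊(2:ℝ) ^ l * ω⌋) ⁻¹' T) g) := by
  intro ω ω' e
  have := h ω ω' e
  have e' : ⌊(2:ℝ) ^ l * ω⌋ = ⌊(2:ℝ) ^ l * ω'⌋ := by rw [floor_half l ω, floor_half l ω', e]
  by_cases hm : ⌊(2:ℝ) ^ l * ω'⌋ ∈ T
  · rw [Set.indicator_of_mem, Set.indicator_of_mem, this]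
    · exact hm
    · simp only [Set.mem_preimage, e']; exact hm
  · rw [Set.indicator_of_notMem, Set.indicator_of_notMem]
    · exact hm
    · simp only [Set.mem_preimage, e']; exact hm

lemma measurable_dyset (l : ℕ) (T : Set ℤ) :
    MeasurableSet[dyadicFiltration l] ((fun ω : ℝ => ⌊(2:ℝ) ^ l * ω⌋) ⁻¹' T) := by
  change MeasurableSet[dyadicAlgebra l] _
  rw [dyadicAlgebra_eq]
  exact ⟨T, trivial, rfl⟩

lemma martingale_avg {X : Type*} [NormedAddCommGroup X] [NormedSpace ℝ X] [CompleteSpace X]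
    {f : ℕ → ℝ → X} (hf : Martingale f dyadicFiltration (volume.restrict (Set.Icc (0 : ℝ) 1)))
    (l k : ℕ) (hk : k < 2 ^ l) :
    f l ((k : ℝ) / 2 ^ l) = (2:ℝ)⁻¹ • (f (l + 1) ((k : ℝ) / 2 ^ l) +
      f (l + 1) ((2 * (k : ℝ) + 1) / 2 ^ (l + 1))) := by
  have hs := measurable_dyset l {(k : ℤ)}
  have h1 := hf.setIntegral_eq (Nat.le_succ l) hs
  have hc : ∀ l, DyConst l (f l) := fun l => dyConst_of_sm (hf.1 l)
  have hs' := dyadicFiltration.le l _ hs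
  rw [← integral_indicator hs', ← integral_indicator hs',
    dy_integral_succ ((hc l).succ.indicator' _), dy_integral_succ ((hc (l+1)).indicator' _)] at h1
  have h2 := smul_right_injective X (r := ((2:ℝ)^l)⁻¹) (by positivity) h1
  have key : ∀ g : ℝ → X, ∑ k' ∈ Finset.range (2 ^ l), (2:ℝ)⁻¹ •
      (Set.indicator ((fun ω : ℝ => ⌊(2:ℝ) ^ l * ω⌋) ⁻¹' {(k : ℤ)}) g ((k' : ℝ) / 2 ^ l) +
       Set.indicator ((fun ω : ℝ => ⌊(2:ℝ) ^ l * ω⌋) ⁻¹' {(k : ℤ)}) g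
        ((2 * (k' : ℝ) + 1) / 2 ^ (l + 1))) =
      (2:ℝ)⁻¹ • (g ((k : ℝ) / 2 ^ l) + g ((2 * (k : ℝ) + 1) / 2 ^ (l + 1))) := by
    intro g
    rw [Finset.sum_eq_single k]
    · rw [Set.indicator_of_mem, Set.indicator_of_mem]
      · simp [floor_pt']
      · simp [floor_pt]
    · intro k' _ hne
      rw [Set.indicator_of_notMem, Set.indicator_of_notMem]
      · simp
      · simpa [floor_pt'] using hne
      · simp only [Set.mem_preimage, floor_pt]; simpa using hne
    · intro h; exact absurd (Finset.mem_range.2 hk) h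
  rw [key, key] at h2
  rw [← h2]
  have : f l ((2 * (k : ℝ) + 1) / 2 ^ (l + 1)) = f l ((k : ℝ) / 2 ^ l) :=
    hc l _ _ (by rw [floor_pt, floor_pt'])
  rw [this, ← two_smul ℝ, smul_smul]
  norm_num

lemma martingale_of_avg {X : Type*} [NormedAddCommGroup X] [NormedSpace ℝ X] [CompleteSpace X]
    {f : ℕ → ℝ → X} (hc : ∀ l, DyConst l (f l))
    (ha : ∀ l k : ℕ, f l ((k : ℝ) / 2 ^ l) = (2:ℝ)⁻¹ • (f (l + 1) ((k : ℝ) / 2 ^ l) +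
      f (l + 1) ((2 * (k : ℝ) + 1) / 2 ^ (l + 1)))) :
    Martingale f dyadicFiltration (volume.restrict (Set.Icc (0 : ℝ) 1)) := by
  refine martingale_nat (fun l => sm_of_dyConst (hc l)) (fun l => (dy_integral (hc l)).1) ?_
  intro l
  refine ae_eq_condExp_of_forall_setIntegral_eq (dyadicFiltration.le l) (dy_integral (hc _)).1
    (fun s _ _ => (dy_integral (hc l)).1.integrableOn) ?_
    (sm_of_dyConst (hc l)).aestronglyMeasurable
  intro s hs _
  have hs0 : MeasurableSet[dyadicAlgebra l] s := hs
  rw [dyadicAlgebra_eq] at hs0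
  obtain ⟨T, -, rfl⟩ := hs0
  have hs' := dyadicFiltration.le l _ hs
  rw [← integral_indicator hs', ← integral_indicator hs',
    dy_integral_succ ((hc l).succ.indicator' _), dy_integral_succ ((hc (l+1)).indicator' _)]
  congr 1
  refine Finset.sum_congr rfl fun k _ => ?_
  have e : f l ((2 * (k : ℝ) + 1) / 2 ^ (l + 1)) = f l ((k : ℝ) / 2 ^ l) :=
    hc l _ _ (by rw [floor_pt, floor_pt'])
  by_cases hk : (k : ℤ) ∈ T
  · rw [Set.indicator_of_mem, Set.indicator_of_mem, Set.indicator_of_mem, Set.indicator_of_mem, e,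
      ← ha l k, ← two_smul ℝ, smul_smul]
    · norm_num
    all_goals simp only [Set.mem_preimage, floor_pt, floor_pt']; exact hk
  · rw [Set.indicator_of_notMem, Set.indicator_of_notMem, Set.indicator_of_notMem,
      Set.indicator_of_notMem]
    all_goals simp only [Set.mem_preimage, floor_pt, floor_pt']; exact hk

/-- The tangent line at `c` of `t ↦ t ^ p`, evaluated at `y`. -/
noncomputable def tanL (p c y : ℝ) : ℝ := (1 - p) * c ^ p + p * c ^ (p - 1) * y

/-- The power function, extended below `b` by its tangent line at `b`. -/
noncomputable def HH (p y b : ℝ) : ℝ := tanL p (max y b) y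

lemma rpow_pred_mul {p b : ℝ} (hp : 1 ≤ p) (hb : 0 ≤ b) : b ^ (p - 1) * b = b ^ p := by
  rcases hb.eq_or_lt with rfl | hb
  · rw [Real.zero_rpow (by linarith : p ≠ 0)]; simp
  · rw [← Real.rpow_add_one hb.ne']; congr 1; ring

lemma tanL_le {p c e : ℝ} (hp : 1 ≤ p) (hc : 0 ≤ c) (he : 0 ≤ e) : tanL p c e ≤ e ^ p := by
  unfold tanL
  rcases hc.eq_or_lt with rfl | hc
  · rw [Real.zero_rpow (by linarith : p ≠ 0)]
    rcases hp.eq_or_lt with rfl | hp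
    · simp
    · rw [Real.zero_rpow (by linarith : p - 1 ≠ 0)]
      simp; positivity
  · have h := one_add_mul_self_le_rpow_one_add (s := e / c - 1) (p := p)
      (by have : 0 ≤ e / c := by positivity
          linarith) hp
    rw [show 1 + (e / c - 1) = e / c by ring, Real.div_rpow he hc.le,
      le_div_iff₀ (by positivity)] at h
    have h1 := rpow_pred_mul hp hc.le
    have : (1 + p * (e / c - 1)) * c ^ p = (1 - p) * c ^ p + p * c ^ (p - 1) * e := by
      rw [← h1]; field_simp; ring
    linarith

lemma tanL_mono {p c y z : ℝ} (hp : 1 ≤ p) (hc : 0 ≤ c) (h : y ≤ z) : tanL p c y ≤ tanL p c z := by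
  unfold tanL
  have : 0 ≤ p * c ^ (p - 1) := by positivity
  nlinarith

lemma tanL_self {p c : ℝ} (hp : 1 ≤ p) (hc : 0 ≤ c) : tanL p c c = c ^ p := by
  unfold tanL
  have := rpow_pred_mul hp hc
  rw [mul_assoc, this]; ring

lemma tanL_le_HH {p c y b : ℝ} (hp : 1 ≤ p) (hb : 0 ≤ b) (hc : b ≤ c) :
    tanL p c y ≤ HH p y b := by
  unfold HH
  rcases le_total b y with h | h
  · rw [max_eq_left h, tanL_self hp (hb.trans h)]
    exact tanL_le hp (hb.trans hc) (hb.trans h)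
  · rw [max_eq_right h]
    have h1 := tanL_le hp (hb.trans hc) hb
    have h2 := tanL_self hp hb
    have h3 : b ^ (p - 1) ≤ c ^ (p - 1) := Real.rpow_le_rpow hb hc (by linarith)
    have h4 : b ^ (p - 1) * (b - y) ≤ c ^ (p - 1) * (b - y) :=
      mul_le_mul_of_nonneg_right h3 (by linarith)
    unfold tanL at *
    nlinarith

lemma HH_le {p y b e : ℝ} (hp : 1 ≤ p) (hb : 0 ≤ b) (hy : y ≤ e) (he : 0 ≤ e) :
    HH p y b ≤ e ^ p :=
  (tanL_mono hp (hb.trans (le_max_right _ _)) hy).trans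
    (tanL_le hp (hb.trans (le_max_right _ _)) he)

lemma HH_lower {p u b : ℝ} (hp : 1 ≤ p) (hb : 0 ≤ b) (hu : 0 ≤ u) :
    (u / 2) ^ p - 2 * p * b ^ p ≤ HH p (u - b) b := by
  have hbp : 0 ≤ b ^ p := by positivity
  unfold HH
  rcases le_total b (u - b) with h | h
  · rw [max_eq_left h, tanL_self hp (hb.trans h)]
    have : (u / 2) ^ p ≤ (u - b) ^ p := Real.rpow_le_rpow (by linarith) (by linarith) (by linarith)
    nlinarith
  · rw [max_eq_right h]
    have : (u / 2) ^ p ≤ b ^ p := Real.rpow_le_rpow (by linarith) (by linarith) (by linarith)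
    have h1 := rpow_pred_mul hp hb
    unfold tanL
    have h2 : 0 ≤ p * b ^ (p - 1) * u := by positivity
    nlinarith

lemma exp_aux {t : ℝ} (h0 : 0 ≤ t) (h1 : t ≤ 1 / 20) : Real.exp (-t - t ^ 2) ≤ 1 - t := by
  have h := Real.quadratic_le_exp_of_nonneg (x := t + t ^ 2) (by positivity)
  have h2 : (1 - t) * Real.exp (t + t ^ 2) ≥ 1 := by
    have : (1 - t) * (1 + (t + t ^ 2) + (t + t ^ 2) ^ 2 / 2) ≤ (1 - t) * Real.exp (t + t ^ 2) :=
      mul_le_mul_of_nonneg_left h (by linarith)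
    have h3 : 1 ≤ (1 - t) * (1 + (t + t ^ 2) + (t + t ^ 2) ^ 2 / 2) := by
      have : (1 - t) * (1 + (t + t ^ 2) + (t + t ^ 2) ^ 2 / 2) - 1 =
        t ^ 2 * (1 / 2 - t / 2 - t ^ 2 / 2 - t ^ 3 / 2) := by ring
      have h5 : 0 ≤ t ^ 2 * (1 / 2 - t / 2 - t ^ 2 / 2 - t ^ 3 / 2) := by
        have : t ^ 2 ≤ 1/20 := by nlinarith
        have : t ^ 3 ≤ 1/20 := by nlinarith
        have : 0 ≤ 1 / 2 - t / 2 - t ^ 2 / 2 - t ^ 3 / 2 := by linarith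
        positivity
      linarith
    linarith
  rw [show -t - t ^ 2 = -(t + t ^ 2) by ring, Real.exp_neg, inv_le_iff_one_le_mul₀ (Real.exp_pos _)]
  linarith

set_option maxHeartbeats 2000000 in
lemma HH_step_aux {p y b D s : ℝ} (hp : 1 ≤ p) (hb : 0 ≤ b) (hD : 0 ≤ D)
    (hs0 : 0 ≤ s) (hs : s ^ 2 ≤ (y + b) * D) :
    HH p (y - (20 * p - 1) * D + 2 * s) (b + 20 * p * D) +
      HH p (y - (20 * p - 1) * D - 2 * s) (b + 20 * p * D) ≤ 2 * HH p y b := by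
  have hpD : 0 ≤ p * D := by positivity
  have hb' : 0 ≤ b + 20 * p * D := by positivity
  rcases le_or_gt (y - (20 * p - 1) * D + 2 * s) (b + 20 * p * D) with h | h
  · have e1 : HH p (y - (20 * p - 1) * D + 2 * s) (b + 20 * p * D) +
      HH p (y - (20 * p - 1) * D - 2 * s) (b + 20 * p * D) =
        2 * tanL p (b + 20 * p * D) (y - (20 * p - 1) * D) := by
      unfold HH
      rw [max_eq_right h, max_eq_right (by linarith)]
      unfold tanL; ring
    have h2 : tanL p (b + 20 * p * D) (y - (20 * p - 1) * D) ≤ tanL p (b + 20 * p * D) y :=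
      tanL_mono hp hb' (by nlinarith)
    have h3 : tanL p (b + 20 * p * D) y ≤ HH p y b := tanL_le_HH hp hb (by linarith)
    linarith
  · have h2s : (b - y) + (40 * p - 1) * D < 2 * s := by linarith
    have hDp : 0 ≤ (40 * p - 1) * D := by nlinarith
    -- the point `y` is almost above `b`
    have hyb : (20 * p - 1) * b ≤ 20 * p * y ∧ 0 < y := by
      rcases le_or_gt y b with hyb | hyb
      · have h4 : ((b - y) + (40 * p - 1) * D) ^ 2 < 4 * ((y + b) * D) := by nlinarith
        have h5 : 4 * ((b - y) * ((40 * p - 1) * D)) ≤ ((b - y) + (40 * p - 1) * D) ^ 2 := by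
          nlinarith [sq_nonneg ((b - y) - (40 * p - 1) * D)]
        have h6 : D * ((b - y) * (40 * p - 1)) < D * (y + b) := by linarith
        have h7 := lt_of_mul_lt_mul_left h6 hD
        have h8 : (20 * p - 1) * b < 20 * p * y := by linarith
        refine ⟨h8.le, ?_⟩
        have : 0 ≤ (20 * p - 1) * b := mul_nonneg (by linarith) hb
        by_contra hy
        have : p * y ≤ 0 := by nlinarith
        linarith
      · exact ⟨by nlinarith, by linarith⟩
    obtain ⟨hyb, hy⟩ := hyb
    have hb2 : b ≤ 2 * y := by
      by_contra hcon
      push Not at hcon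
      nlinarith
    have hs3 : s ^ 2 ≤ 3 * y * D := by nlinarith
    obtain ⟨τ, hτ⟩ : ∃ τ, τ = D / y := ⟨_, rfl⟩
    obtain ⟨σ, hσ⟩ : ∃ σ, σ = s / y := ⟨_, rfl⟩
    have hDτ : D = τ * y := by rw [hτ]; field_simp
    have hsσ : s = σ * y := by rw [hσ]; field_simp
    have hτ0 : 0 ≤ τ := by rw [hτ]; positivity
    have hσ0 : 0 ≤ σ := by rw [hσ]; positivity
    have hστ : σ ^ 2 ≤ 3 * τ := by
      rw [hDτ, hsσ] at hs3
      have : σ ^ 2 * y ^ 2 ≤ 3 * τ * y ^ 2 := by linarith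
      exact le_of_mul_le_mul_right this (by positivity)
    have key : ∀ x : ℝ, HH p (y - (20 * p - 1) * D + 2 * (x * y)) (b + 20 * p * D) ≤
        y ^ p * (Real.exp (-(p * (20 * p - 1) * τ)) * Real.exp (2 * p * x)) := by
      intro x
      have h1 : y - (20 * p - 1) * D + 2 * (x * y) ≤
          y * Real.exp (-((20 * p - 1) * τ) + 2 * x) := by
        have := Real.add_one_le_exp (-((20 * p - 1) * τ) + 2 * x)
        rw [hDτ]
        nlinarith
      refine (HH_le hp hb' h1 (by positivity)).trans (le_of_eq ?_)
      rw [Real.mul_rpow hy.le (Real.exp_pos _).le, ← Real.exp_mul, ← Real.exp_add]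
      congr 2
      ring
    have k1 := key σ
    have k2 := key (-σ)
    rw [← hsσ] at k1
    rw [show y - (20 * p - 1) * D + 2 * (-σ * y) = y - (20 * p - 1) * D - 2 * s by
      rw [hsσ]; ring] at k2
    have hcosh := Real.cosh_le_exp_half_sq (2 * p * σ)
    rw [Real.cosh_eq] at hcosh
    have hyp : 0 < y ^ p := by positivity
    have hE := Real.exp_pos (-(p * (20 * p - 1) * τ))
    have hsum : HH p (y - (20 * p - 1) * D + 2 * s) (b + 20 * p * D) +
        HH p (y - (20 * p - 1) * D - 2 * s) (b + 20 * p * D) ≤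
        2 * (y ^ p * Real.exp (-(13 * p ^ 2 * τ))) := by
      have h1 : Real.exp (2 * p * σ) + Real.exp (2 * p * -σ) ≤
          2 * Real.exp ((2 * p * σ) ^ 2 / 2) := by
        rw [show 2 * p * -σ = -(2 * p * σ) by ring]
        linarith
      have h2 : Real.exp (-(p * (20 * p - 1) * τ)) * Real.exp ((2 * p * σ) ^ 2 / 2) ≤
          Real.exp (-(13 * p ^ 2 * τ)) := by
        rw [← Real.exp_add, Real.exp_le_exp]
        have e1 : p ^ 2 * σ ^ 2 ≤ p ^ 2 * (3 * τ) := by gcongr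
        have e2 : p * τ ≤ p ^ 2 * τ := by nlinarith
        nlinarith
      have h3 : Real.exp (-(p * (20 * p - 1) * τ)) *
          (Real.exp (2 * p * σ) + Real.exp (2 * p * -σ)) ≤
          Real.exp (-(p * (20 * p - 1) * τ)) * (2 * Real.exp ((2 * p * σ) ^ 2 / 2)) :=
        mul_le_mul_of_nonneg_left h1 hE.le
      have h4 : y ^ p * (Real.exp (-(p * (20 * p - 1) * τ)) *
          (Real.exp (2 * p * σ) + Real.exp (2 * p * -σ))) ≤
          y ^ p * (2 * Real.exp (-(13 * p ^ 2 * τ))) :=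
        mul_le_mul_of_nonneg_left (by linarith) hyp.le
      linarith
    refine hsum.trans ?_
    refine mul_le_mul_of_nonneg_left ?_ (by norm_num)
    rcases le_or_gt b y with hby | hby
    · unfold HH
      rw [max_eq_left hby, tanL_self hp hy.le]
      have : Real.exp (-(13 * p ^ 2 * τ)) ≤ 1 := by
        rw [Real.exp_le_one_iff]
        have : 0 ≤ 13 * p ^ 2 * τ := by positivity
        linarith
      nlinarith
    · have hbpos : 0 < b := hy.trans hby
      obtain ⟨θ, hθ⟩ : ∃ θ, θ = 1 - y / b := ⟨_, rfl⟩
      have hyθ : y = b * (1 - θ) := by rw [hθ]; field_simp; ring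
      have hθ0 : 0 ≤ θ := by
        rw [hθ]
        have : y / b ≤ 1 := by rw [div_le_one hbpos]; exact hby.le
        linarith
      have hθ1 : p * θ ≤ 1 / 20 := by
        rw [hyθ] at hyb
        have : b * (20 * (p * θ)) ≤ b * 1 := by nlinarith
        have := le_of_mul_le_mul_left this hbpos
        linarith
      have hθτ : θ ^ 2 ≤ 12 * τ := by
        have h1 : b * θ ≤ 2 * (σ * y) := by
          rw [← hsσ]
          have : b * θ = b - y := by rw [hyθ]; ring
          linarith
        have h2 : y * θ ≤ 2 * (σ * y) := by nlinarith
        have h3 : θ ≤ 2 * σ := by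
          have : y * θ ≤ y * (2 * σ) := by linarith
          exact le_of_mul_le_mul_left this hy
        nlinarith
      unfold HH
      rw [max_eq_right hby.le]
      have e1 : tanL p b y = b ^ p * (1 - p * θ) := by
        unfold tanL
        rw [← rpow_pred_mul hp hb]
        conv_lhs => rw [hyθ]
        ring
      rw [e1]
      have e2 : y ^ p ≤ b ^ p * Real.exp (-(p * θ)) := by
        have : y ≤ b * Real.exp (-θ) := by
          have := Real.add_one_le_exp (-θ)
          rw [hyθ]; nlinarith
        refine (Real.rpow_le_rpow hy.le this (by linarith)).trans (le_of_eq ?_)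
        rw [Real.mul_rpow hb (Real.exp_pos _).le, ← Real.exp_mul]
        congr 2; ring
      have e3 := exp_aux (t := p * θ) (by positivity) hθ1
      have e4 : Real.exp (-(p * θ)) * Real.exp (-(13 * p ^ 2 * τ)) ≤ 1 - p * θ := by
        rw [← Real.exp_add]
        refine le_trans (Real.exp_le_exp.2 ?_) e3
        have : p ^ 2 * θ ^ 2 ≤ p ^ 2 * (12 * τ) := by gcongr
        have : 0 ≤ p ^ 2 * τ := by positivity
        nlinarith
      calc y ^ p * Real.exp (-(13 * p ^ 2 * τ))
          ≤ (b ^ p * Real.exp (-(p * θ))) * Real.exp (-(13 * p ^ 2 * τ)) := by gcongr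
        _ = b ^ p * (Real.exp (-(p * θ)) * Real.exp (-(13 * p ^ 2 * τ))) := by ring
        _ ≤ b ^ p * (1 - p * θ) := by gcongr

/-- First Bellman function. -/
noncomputable def Phi1 (p u A : ℝ) : ℝ := HH p (u - 20 * p * A) (20 * p * A)

/-- Second Bellman function. -/
noncomputable def Phi2 (p u A : ℝ) : ℝ := A ^ p - p * A ^ (p - 1) * u

lemma Phi1_step {p u A D s : ℝ} (hp : 1 ≤ p) (hA : 0 ≤ A) (hD : 0 ≤ D)
    (hs : s ^ 2 ≤ u * D) :
    Phi1 p (u + D + 2 * s) (A + D) + Phi1 p (u + D - 2 * s) (A + D) ≤ 2 * Phi1 p u A := by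
  unfold Phi1
  have hb : 0 ≤ 20 * p * A := by positivity
  have e1 : u + D + 2 * s - 20 * p * (A + D) = (u - 20 * p * A) - (20 * p - 1) * D + 2 * s := by ring
  have e2 : u + D - 2 * s - 20 * p * (A + D) = (u - 20 * p * A) - (20 * p - 1) * D - 2 * s := by ring
  have e3 : 20 * p * (A + D) = 20 * p * A + 20 * p * D := by ring
  rw [e1, e2, e3]
  rcases le_total 0 s with h | h
  · exact HH_step_aux hp hb hD h (by linarith)
  · have := HH_step_aux (y := u - 20 * p * A) (s := -s) hp hb hD (by linarith)
      (by rw [neg_sq]; linarith)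
    rw [show (u - 20 * p * A) - (20 * p - 1) * D + 2 * -s =
      (u - 20 * p * A) - (20 * p - 1) * D - 2 * s by ring,
      show (u - 20 * p * A) - (20 * p - 1) * D - 2 * -s =
      (u - 20 * p * A) - (20 * p - 1) * D + 2 * s by ring] at this
    linarith

lemma Phi2_step {p u A D s : ℝ} (hp : 1 ≤ p) (hA : 0 ≤ A) (hD : 0 ≤ D) (hu : 0 ≤ u) :
    Phi2 p (u + D + 2 * s) (A + D) + Phi2 p (u + D - 2 * s) (A + D) ≤ 2 * Phi2 p u A := by
  unfold Phi2
  have h1 := tanL_le hp (add_nonneg hA hD) hA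
  have h2 := rpow_pred_mul hp (add_nonneg hA hD)
  have h3 : A ^ (p - 1) ≤ (A + D) ^ (p - 1) := Real.rpow_le_rpow hA (by linarith) (by linarith)
  have h4 : p * u * A ^ (p - 1) ≤ p * u * (A + D) ^ (p - 1) :=
    mul_le_mul_of_nonneg_left h3 (by positivity)
  unfold tanL at h1
  nlinarith

lemma Phi1_zero {p : ℝ} (hp : 1 ≤ p) : Phi1 p 0 0 = 0 := by
  unfold Phi1 HH
  simp
  rw [tanL_self hp le_rfl, Real.zero_rpow (by linarith)]

lemma Phi2_zero {p : ℝ} (hp : 1 ≤ p) : Phi2 p 0 0 = 0 := by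
  unfold Phi2
  rw [Real.zero_rpow (by linarith)]; simp

lemma Phi1_lower {p u A : ℝ} (hp : 1 ≤ p) (hA : 0 ≤ A) (hu : 0 ≤ u) :
    u ^ p ≤ 2 ^ p * Phi1 p u A + (160 * p) ^ p * A ^ p := by
  have h := HH_lower (b := 20 * p * A) hp (by positivity) hu
  have h2 : 0 < (2:ℝ) ^ p := by positivity
  rw [Real.div_rpow hu (by norm_num), Real.mul_rpow (by positivity) hA] at h
  have h3 : u ^ p ≤ 2 ^ p * Phi1 p u A + 2 ^ p * (2 * p) * ((20 * p) ^ p * A ^ p) := by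
    have : u ^ p = 2 ^ p * (u ^ p / 2 ^ p) := by field_simp
    rw [this]
    unfold Phi1
    have := mul_le_mul_of_nonneg_left h h2.le
    linarith
  have h4 : 2 * p ≤ 4 ^ p := by
    have := one_add_mul_self_le_rpow_one_add (s := 3) (p := p) (by norm_num) hp
    norm_num at this
    linarith
  have h5 : (160 * p) ^ p = 2 ^ p * 4 ^ p * (20 * p) ^ p := by
    rw [← Real.mul_rpow (by norm_num) (by norm_num), ← Real.mul_rpow (by norm_num) (by positivity)]
    congr 1; ring
  rw [h5]
  have h6 : 2 ^ p * (2 * p) * ((20 * p) ^ p * A ^ p) ≤ 2 ^ p * 4 ^ p * ((20 * p) ^ p * A ^ p) := by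
    gcongr
  linarith

lemma Phi2_lower {p u A : ℝ} (hp : 1 ≤ p) (hA : 0 ≤ A) (hu : 0 ≤ u) :
    A ^ p ≤ 2 * Phi2 p u A + (2 * p) ^ p * u ^ p := by
  unfold Phi2
  have hAp : 0 ≤ A ^ (p - 1) := by positivity
  have h1 := rpow_pred_mul hp hA
  rw [← Real.mul_rpow (by positivity) hu]
  have h2 : 0 ≤ (2 * p * u) ^ p := by positivity
  rcases le_total (2 * p * u) A with h | h
  · have : A ^ (p - 1) * (2 * p * u) ≤ A ^ (p - 1) * A := mul_le_mul_of_nonneg_left h hAp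
    linarith
  · have h3 := rpow_pred_mul hp (hA.trans h)
    have h4 : A ^ (p - 1) ≤ (2 * p * u) ^ (p - 1) := Real.rpow_le_rpow hA h (by linarith)
    have h5 : A ^ (p - 1) * (2 * p * u) ≤ (2 * p * u) ^ (p - 1) * (2 * p * u) :=
      mul_le_mul_of_nonneg_right h4 (hA.trans h)
    have : 0 ≤ A ^ p := by positivity
    linarith

/-- A positive semidefinite symmetric real bilinear form, unbundled. -/
structure IsForm {X : Type*} [NormedAddCommGroup X] [NormedSpace ℝ X] (B : X → X → ℝ) : Prop where
  symm : ∀ x y, B x y = B y x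
  add : ∀ x y z, B (x + y) z = B x z + B y z
  smul : ∀ (r : ℝ) x y, B (r • x) y = r * B x y
  nonneg : ∀ x, 0 ≤ B x x

section form
variable {X : Type*} [NormedAddCommGroup X] [NormedSpace ℝ X] {B : X → X → ℝ}

lemma IsForm.add_right (h : IsForm B) (x y z : X) : B x (y + z) = B x y + B x z := by
  rw [h.symm x, h.add, h.symm y, h.symm z]

lemma IsForm.smul_right (h : IsForm B) (r : ℝ) (x y : X) : B x (r • y) = r * B x y := by
  rw [h.symm x, h.smul, h.symm y]

lemma IsForm.self_add (h : IsForm B) (x d : X) : B (x + d) (x + d) = B x x + B d d + 2 * B x d := by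
  rw [h.add, h.add_right, h.add_right, h.symm d x]; ring

lemma IsForm.neg_left (h : IsForm B) (x y : X) : B (-x) y = - B x y := by
  rw [← neg_one_smul ℝ x, h.smul]; ring

lemma IsForm.neg_right (h : IsForm B) (x y : X) : B x (-y) = - B x y := by
  rw [h.symm, h.neg_left, h.symm]

lemma IsForm.self_sub (h : IsForm B) (x d : X) : B (x - d) (x - d) = B x x + B d d - 2 * B x d := by
  rw [sub_eq_add_neg, h.self_add, h.neg_left, h.neg_right, h.neg_right]; ring

lemma IsForm.cs (h : IsForm B) {M : ℕ} (x d : Fin M → X) :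
    (∑ j, B (x j) (d j)) ^ 2 ≤ (∑ j, B (x j) (x j)) * ∑ j, B (d j) (d j) := by
  have key : ∀ t : ℝ, 0 ≤ (∑ j, B (x j) (x j)) * (t * t) + (2 * ∑ j, B (x j) (d j)) * t +
      ∑ j, B (d j) (d j) := by
    intro t
    have h1 : 0 ≤ ∑ j, B (t • x j + d j) (t • x j + d j) :=
      Finset.sum_nonneg fun j _ => h.nonneg _
    have h2 : ∑ j, B (t • x j + d j) (t • x j + d j) =
        (∑ j, B (x j) (x j)) * (t * t) + (2 * ∑ j, B (x j) (d j)) * t + ∑ j, B (d j) (d j) := by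
      rw [Finset.sum_mul, Finset.mul_sum, Finset.sum_mul, ← Finset.sum_add_distrib,
        ← Finset.sum_add_distrib]
      refine Finset.sum_congr rfl fun j _ => ?_
      rw [h.self_add, h.smul, h.smul_right, h.smul]; ring
    linarith
  have := discrim_le_zero key
  unfold discrim at this
  linarith

/-- sum of squares of the martingales -/
def uu {M : ℕ} (B : X → X → ℝ) (f : Fin M → ℕ → ℝ → X) (l : ℕ) (ω : ℝ) : ℝ :=
  ∑ j, B (f j l ω) (f j l ω)

/-- sum of squares of the square functions -/
def AA {M : ℕ} (B : X → X → ℝ) (f : Fin M → ℕ → ℝ → X) (l : ℕ) (ω : ℝ) : ℝ :=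
  ∑ j, ∑ i ∈ Finset.range l, B (f j (i + 1) ω - f j i ω) (f j (i + 1) ω - f j i ω)

lemma uu_nonneg (h : IsForm B) {M : ℕ} (f : Fin M → ℕ → ℝ → X) (l : ℕ) (ω : ℝ) :
    0 ≤ uu B f l ω := Finset.sum_nonneg fun _ _ => h.nonneg _

lemma AA_nonneg (h : IsForm B) {M : ℕ} (f : Fin M → ℕ → ℝ → X) (l : ℕ) (ω : ℝ) :
    0 ≤ AA B f l ω := Finset.sum_nonneg fun _ _ => Finset.sum_nonneg fun _ _ => h.nonneg _

lemma uu_dy {M : ℕ} {f : Fin M → ℕ → ℝ → X} (hc : ∀ j l, DyConst l (f j l)) (l : ℕ) :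
    DyConst l (uu B f l) := by
  intro ω ω' e
  unfold uu
  refine Finset.sum_congr rfl fun j _ => ?_
  rw [hc j l ω ω' e]

lemma AA_dy {M : ℕ} {f : Fin M → ℕ → ℝ → X} (hc : ∀ j l, DyConst l (f j l)) (l : ℕ) :
    DyConst l (AA B f l) := by
  intro ω ω' e
  unfold AA
  refine Finset.sum_congr rfl fun j _ => Finset.sum_congr rfl fun i hi => ?_
  have hi := Finset.mem_range.1 hi
  rw [(hc j (i + 1)).mono hi ω ω' e, (hc j i).mono hi.le ω ω' e]

lemma AA_succ {M : ℕ} (f : Fin M → ℕ → ℝ → X) (l : ℕ) (ω : ℝ) :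
    AA B f (l + 1) ω = AA B f l ω +
      ∑ j, B (f j (l + 1) ω - f j l ω) (f j (l + 1) ω - f j l ω) := by
  unfold AA
  rw [← Finset.sum_add_distrib]
  refine Finset.sum_congr rfl fun j _ => ?_
  rw [Finset.sum_range_succ]

lemma dy_comp2 {l : ℕ} {g h : ℝ → ℝ} (hg : DyConst l g) (hh : DyConst l h) (Φ : ℝ → ℝ → ℝ) :
    DyConst l (fun ω => Φ (g ω) (h ω)) := by
  intro ω ω' e
  simp only
  rw [hg ω ω' e, hh ω ω' e]

lemma bellman [CompleteSpace X] (h : IsForm B) {M : ℕ} {f : Fin M → ℕ → ℝ → X}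
    (hf : ∀ j, Martingale (f j) dyadicFiltration (volume.restrict (Set.Icc (0 : ℝ) 1)))
    (h0 : ∀ j, f j 0 = 0) {Φ : ℝ → ℝ → ℝ} (hΦ0 : Φ 0 0 = 0)
    (hΦ : ∀ u A D s : ℝ, 0 ≤ u → 0 ≤ A → 0 ≤ D → s ^ 2 ≤ u * D →
      Φ (u + D + 2 * s) (A + D) + Φ (u + D - 2 * s) (A + D) ≤ 2 * Φ u A) (n : ℕ) :
    ∫ ω, Φ (uu B f n ω) (AA B f n ω) ∂(volume.restrict (Set.Icc (0 : ℝ) 1)) ≤ 0 := by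
  have hc : ∀ j l, DyConst l (f j l) := fun j l => dyConst_of_sm ((hf j).1 l)
  induction n with
  | zero =>
    have : ∀ ω, Φ (uu B f 0 ω) (AA B f 0 ω) = 0 := by
      intro ω
      have h1 : uu B f 0 ω = 0 := by
        unfold uu
        refine Finset.sum_eq_zero fun j _ => ?_
        rw [h0 j, Pi.zero_apply, ← zero_smul ℝ (0 : X), h.smul, zero_mul]
      have h2 : AA B f 0 ω = 0 := by simp [AA]
      rw [h1, h2, hΦ0]
    simp [this]
  | succ l ih =>
    refine le_trans ?_ ih
    rw [dy_integral_succ (dy_comp2 (uu_dy hc (l + 1)) (AA_dy hc (l + 1)) Φ),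
      (dy_integral (dy_comp2 (uu_dy hc l) (AA_dy hc l) Φ)).2]
    simp only [smul_eq_mul]
    refine mul_le_mul_of_nonneg_left (Finset.sum_le_sum fun k hk => ?_) (by positivity)
    have hk := Finset.mem_range.1 hk
    obtain ⟨ω₀, hω₀⟩ : ∃ ω₀, ω₀ = (k : ℝ) / 2 ^ l := ⟨_, rfl⟩
    obtain ⟨ω₁, hω₁⟩ : ∃ ω₁, ω₁ = (2 * (k : ℝ) + 1) / 2 ^ (l + 1) := ⟨_, rfl⟩
    have hfl : ⌊(2:ℝ) ^ l * ω₁⌋ = ⌊(2:ℝ) ^ l * ω₀⌋ := by rw [hω₀, hω₁, floor_pt, floor_pt']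
    have havg : ∀ j, f j l ω₀ = (2:ℝ)⁻¹ • (f j (l + 1) ω₀ + f j (l + 1) ω₁) := by
      intro j
      rw [hω₀, hω₁]
      exact martingale_avg (hf j) l k hk
    rw [← hω₀, ← hω₁]
    obtain ⟨d, hd⟩ : ∃ d : Fin M → X, ∀ j, d j = f j (l + 1) ω₀ - f j l ω₀ := ⟨_, fun _ => rfl⟩
    have e0 : ∀ j, f j (l + 1) ω₀ = f j l ω₀ + d j := fun j => by rw [hd]; abel
    have e1 : ∀ j, f j (l + 1) ω₁ = f j l ω₀ - d j := fun j => by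
      have h2 : f j (l + 1) ω₀ + f j (l + 1) ω₁ = (2:ℝ) • f j l ω₀ := by
        rw [havg j, smul_smul]; norm_num
      rw [two_smul] at h2
      rw [hd, eq_sub_of_add_eq' h2]; abel
    have e2 : ∀ j, f j l ω₁ = f j l ω₀ := fun j => hc j l _ _ hfl
    have u0 : uu B f (l + 1) ω₀ = uu B f l ω₀ + (∑ j, B (d j) (d j)) +
        2 * ∑ j, B (f j l ω₀) (d j) := by
      unfold uu
      rw [Finset.mul_sum, ← Finset.sum_add_distrib, ← Finset.sum_add_distrib]
      exact Finset.sum_congr rfl fun j _ => by rw [e0, h.self_add]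
    have u1 : uu B f (l + 1) ω₁ = uu B f l ω₀ + (∑ j, B (d j) (d j)) -
        2 * ∑ j, B (f j l ω₀) (d j) := by
      unfold uu
      rw [Finset.mul_sum, ← Finset.sum_add_distrib, ← Finset.sum_sub_distrib]
      exact Finset.sum_congr rfl fun j _ => by rw [e1, h.self_sub]
    have A0 : AA B f (l + 1) ω₀ = AA B f l ω₀ + ∑ j, B (d j) (d j) := by
      rw [AA_succ]
      simp only [hd]
    have A1 : AA B f (l + 1) ω₁ = AA B f l ω₀ + ∑ j, B (d j) (d j) := by
      rw [AA_succ, AA_dy hc l _ _ hfl]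
      congr 1
      refine Finset.sum_congr rfl fun j _ => ?_
      rw [e1, e2, show f j l ω₀ - d j - f j l ω₀ = -d j by abel, h.neg_left, h.neg_right, neg_neg]
    rw [u0, u1, A0, A1]
    have := hΦ (uu B f l ω₀) (AA B f l ω₀) (∑ j, B (d j) (d j)) (∑ j, B (f j l ω₀) (d j))
      (uu_nonneg h f l ω₀) (AA_nonneg h f l ω₀) (Finset.sum_nonneg fun _ _ => h.nonneg _)
      (h.cs _ _)
    linarith

lemma hilbert_ineq [CompleteSpace X] (h : IsForm B) {M : ℕ} {f : Fin M → ℕ → ℝ → X}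
    (hf : ∀ j, Martingale (f j) dyadicFiltration (volume.restrict (Set.Icc (0 : ℝ) 1)))
    (h0 : ∀ j, f j 0 = 0) (n : ℕ) {p : ℝ} (hp : 1 ≤ p) :
    (∫ ω, uu B f n ω ^ p ∂(volume.restrict (Set.Icc (0 : ℝ) 1)) ≤
      (160 * p) ^ p * ∫ ω, AA B f n ω ^ p ∂(volume.restrict (Set.Icc (0 : ℝ) 1))) ∧
    (∫ ω, AA B f n ω ^ p ∂(volume.restrict (Set.Icc (0 : ℝ) 1)) ≤
      (160 * p) ^ p * ∫ ω, uu B f n ω ^ p ∂(volume.restrict (Set.Icc (0 : ℝ) 1))) := by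
  have hc : ∀ j l, DyConst l (f j l) := fun j l => dyConst_of_sm ((hf j).1 l)
  have i1 := fun Φ : ℝ → ℝ → ℝ => (dy_integral (dy_comp2 (uu_dy (B := B) hc n) (AA_dy (B := B) hc n) Φ)).1
  have b1 := bellman (Φ := Phi1 p) h hf h0 (Phi1_zero hp)
    (fun u A D s hu hA hD hs => Phi1_step hp hA hD hs) n
  have b2 := bellman (Φ := Phi2 p) h hf h0 (Phi2_zero hp)
    (fun u A D s hu hA hD hs => Phi2_step hp hA hD hu) n
  have j1 := i1 (fun u _ => u ^ p)
  have j2 := i1 (fun _ A => A ^ p)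
  have k1 := i1 (Phi1 p)
  have k2 := i1 (Phi2 p)
  constructor
  · have := integral_mono j1 ((k1.const_mul (2 ^ p)).add (j2.const_mul ((160 * p) ^ p)))
      (fun ω => Phi1_lower hp (AA_nonneg h f n ω) (uu_nonneg h f n ω))
    simp only [Pi.add_apply] at this
    rw [integral_add (k1.const_mul _) (j2.const_mul _), integral_const_mul, integral_const_mul] at this
    have h2 : (0:ℝ) < 2 ^ p := by positivity
    nlinarith
  · have := integral_mono j2 ((k2.const_mul 2).add (j1.const_mul ((2 * p) ^ p)))
      (fun ω => Phi2_lower hp (AA_nonneg h f n ω) (uu_nonneg h f n ω))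
    simp only [Pi.add_apply] at this
    rw [integral_add (k2.const_mul _) (j1.const_mul _), integral_const_mul, integral_const_mul] at this
    have h2 : (2 * p) ^ p ≤ (160 * p) ^ p := Real.rpow_le_rpow (by positivity) (by linarith) (by linarith)
    have h3 : 0 ≤ ∫ ω, uu B f n ω ^ p ∂(volume.restrict (Set.Icc (0 : ℝ) 1)) :=
      integral_nonneg fun ω => Real.rpow_nonneg (uu_nonneg h f n ω) _
    nlinarith

/-- Passing from the form to an equivalent norm. -/
lemma final_cmp {r c₁ c₂ : ℝ} (hr : 2 ≤ r) (hc₁ : 0 < c₁) (hc₂ : 0 < c₂) {μ : Measure ℝ}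
    {a b a' b' : ℝ → ℝ} (ha : ∀ ω, 0 ≤ a ω) (hb : ∀ ω, 0 ≤ b ω)
    (h1 : ∀ ω, c₁ ^ 2 * a ω ≤ a' ω) (h2 : ∀ ω, b' ω ≤ c₂ ^ 2 * b ω) (hb' : ∀ ω, 0 ≤ b' ω)
    (ia : Integrable (fun ω => a ω ^ (r / 2)) μ) (ib : Integrable (fun ω => b ω ^ (r / 2)) μ)
    (ia' : Integrable (fun ω => a' ω ^ (r / 2)) μ) (ib' : Integrable (fun ω => b' ω ^ (r / 2)) μ)
    (h : ∫ ω, a' ω ^ (r / 2) ∂μ ≤ (160 * (r / 2)) ^ (r / 2) * ∫ ω, b' ω ^ (r / 2) ∂μ) :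
    (∫ ω, a ω ^ (r / 2) ∂μ) ^ (1 / r) ≤
      (c₂ / c₁ * 9) * r ^ (1 / (2:ℝ)) * (∫ ω, b ω ^ (r / 2) ∂μ) ^ (1 / r) := by
  have hr0 : 0 < r := by linarith
  have e1 : (c₁ ^ 2) ^ (r / 2) * ∫ ω, a ω ^ (r / 2) ∂μ ≤ ∫ ω, a' ω ^ (r / 2) ∂μ := by
    rw [← integral_const_mul]
    refine integral_mono (ia.const_mul _) ia' fun ω => ?_
    simp only
    rw [← Real.mul_rpow (by positivity) (ha ω)]
    exact Real.rpow_le_rpow (mul_nonneg (by positivity) (ha ω)) (h1 ω) (by positivity)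
  have e2 : ∫ ω, b' ω ^ (r / 2) ∂μ ≤ (c₂ ^ 2) ^ (r / 2) * ∫ ω, b ω ^ (r / 2) ∂μ := by
    rw [← integral_const_mul]
    refine integral_mono ib' (ib.const_mul _) fun ω => ?_
    simp only
    rw [← Real.mul_rpow (by positivity) (hb ω)]
    exact Real.rpow_le_rpow (hb' ω) (h2 ω) (by positivity)
  have hIa : 0 ≤ ∫ ω, a ω ^ (r / 2) ∂μ := integral_nonneg fun ω => Real.rpow_nonneg (ha ω) _
  have hIb : 0 ≤ ∫ ω, b ω ^ (r / 2) ∂μ := integral_nonneg fun ω => Real.rpow_nonneg (hb ω) _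
  have e3 : ∫ ω, a ω ^ (r / 2) ∂μ ≤
      ((c₂ / c₁ * 9) * r ^ (1 / (2:ℝ))) ^ r * ∫ ω, b ω ^ (r / 2) ∂μ := by
    have hk : (160 * (r / 2)) ^ (r / 2) * (c₂ ^ 2) ^ (r / 2) ≤
        (c₁ ^ 2) ^ (r / 2) * ((c₂ / c₁ * 9) * r ^ (1 / (2:ℝ))) ^ r := by
      have : ((c₂ / c₁ * 9) * r ^ (1 / (2:ℝ))) ^ r =
          (((c₂ / c₁ * 9) * r ^ (1 / (2:ℝ))) ^ 2) ^ (r / 2) := by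
        rw [← Real.rpow_natCast, ← Real.rpow_mul (by positivity)]
        congr 1; push_cast; ring
      rw [this, ← Real.mul_rpow (by positivity) (by positivity),
        ← Real.mul_rpow (by positivity) (by positivity)]
      refine Real.rpow_le_rpow (by positivity) ?_ (by positivity)
      have hs : (r ^ (1 / (2:ℝ))) ^ 2 = r := by
        rw [← Real.sqrt_eq_rpow, Real.sq_sqrt hr0.le]
      rw [mul_pow, hs]
      have : c₁ ^ 2 * ((c₂ / c₁ * 9) ^ 2 * r) = 81 * c₂ ^ 2 * r := by field_simp; ring
      rw [this]
      have : 0 ≤ c₂ ^ 2 * r := by positivity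
      nlinarith
    have hpos : 0 < (c₁ ^ 2) ^ (r / 2) := by positivity
    refine le_of_mul_le_mul_left ?_ hpos
    calc _ ≤ _ := e1
      _ ≤ _ := h
      _ ≤ (160 * (r / 2)) ^ (r / 2) * ((c₂ ^ 2) ^ (r / 2) * ∫ ω, b ω ^ (r / 2) ∂μ) := by gcongr
      _ = ((160 * (r / 2)) ^ (r / 2) * (c₂ ^ 2) ^ (r / 2)) * ∫ ω, b ω ^ (r / 2) ∂μ := by ring
      _ ≤ ((c₁ ^ 2) ^ (r / 2) * ((c₂ / c₁ * 9) * r ^ (1 / (2:ℝ))) ^ r) *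
            ∫ ω, b ω ^ (r / 2) ∂μ := by gcongr
      _ = _ := by ring
  refine (Real.rpow_le_rpow hIa e3 (by positivity)).trans (le_of_eq ?_)
  rw [Real.mul_rpow (by positivity) hIb, ← Real.rpow_mul (by positivity), mul_one_div_cancel hr0.ne',
    Real.rpow_one]

lemma forward_dir [CompleteSpace X] (h : IsForm B) {C₁ C₂ : ℝ} (hC₁ : 0 < C₁) (hC₂ : 0 < C₂)
    (hle : ∀ x, C₁ * ‖x‖ ≤ Real.sqrt (B x x)) (hge : ∀ x, Real.sqrt (B x x) ≤ C₂ * ‖x‖)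
    {M : ℕ} {f : Fin M → ℕ → ℝ → X}
    (hf : ∀ j, Martingale (f j) dyadicFiltration (volume.restrict (Set.Icc (0 : ℝ) 1)))
    (h0 : ∀ j, f j 0 = 0) (n : ℕ) {r : ℝ} (hr : 2 ≤ r) :
        ((∫ ω, (∑ j, ‖f j n ω‖ ^ 2) ^ (r / 2)
            ∂(volume.restrict (Set.Icc (0 : ℝ) 1))) ^ (1 / r)
          ≤ (C₂ / C₁ * 9) * r ^ (1 / (2 : ℝ)) *
            (∫ ω, (∑ j, ∑ l ∈ Finset.range n, ‖f j (l + 1) ω - f j l ω‖ ^ 2) ^ (r / 2)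
              ∂(volume.restrict (Set.Icc (0 : ℝ) 1))) ^ (1 / r)) ∧
        ((∫ ω, (∑ j, ∑ l ∈ Finset.range n, ‖f j (l + 1) ω - f j l ω‖ ^ 2) ^ (r / 2)
            ∂(volume.restrict (Set.Icc (0 : ℝ) 1))) ^ (1 / r)
          ≤ (C₂ / C₁ * 9) * r ^ (1 / (2 : ℝ)) *
            (∫ ω, (∑ j, ‖f j n ω‖ ^ 2) ^ (r / 2)
              ∂(volume.restrict (Set.Icc (0 : ℝ) 1))) ^ (1 / r)) := by
  have hc : ∀ j l, DyConst l (f j l) := fun j l => dyConst_of_sm ((hf j).1 l)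
  obtain ⟨k1, k2⟩ := hilbert_ineq h hf h0 n (p := r / 2) (by linarith)
  have hle' : ∀ x, C₁ ^ 2 * ‖x‖ ^ 2 ≤ B x x := fun x => by
    rw [← mul_pow, ← Real.sq_sqrt (h.nonneg x)]
    exact pow_le_pow_left₀ (by positivity) (hle x) 2
  have hge' : ∀ x, B x x ≤ C₂ ^ 2 * ‖x‖ ^ 2 := fun x => by
    rw [← mul_pow, ← Real.sq_sqrt (h.nonneg x)]
    exact pow_le_pow_left₀ (Real.sqrt_nonneg _) (hge x) 2
  have du : DyConst n (fun ω => ∑ j, ‖f j n ω‖ ^ 2) := uu_dy (B := fun x _ => ‖x‖ ^ 2) hc n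
  have dA : DyConst n (fun ω => ∑ j, ∑ l ∈ Finset.range n, ‖f j (l + 1) ω - f j l ω‖ ^ 2) :=
    AA_dy (B := fun x _ => ‖x‖ ^ 2) hc n
  have du' := uu_dy (B := B) hc n
  have dA' := AA_dy (B := B) hc n
  have ii : ∀ g : ℝ → ℝ, DyConst n g →
      Integrable (fun ω => g ω ^ (r / 2)) (volume.restrict (Set.Icc (0 : ℝ) 1)) :=
    fun g hg => (dy_integral (dy_comp2 hg hg (fun a _ => a ^ (r / 2)))).1
  have nu : ∀ ω, 0 ≤ ∑ j, ‖f j n ω‖ ^ 2 := fun ω => Finset.sum_nonneg fun _ _ => by positivity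
  have nA : ∀ ω, 0 ≤ ∑ j, ∑ l ∈ Finset.range n, ‖f j (l + 1) ω - f j l ω‖ ^ 2 := fun ω =>
    Finset.sum_nonneg fun _ _ => Finset.sum_nonneg fun _ _ => by positivity
  have lu : ∀ ω, C₁ ^ 2 * ∑ j, ‖f j n ω‖ ^ 2 ≤ uu B f n ω := fun ω => by
    unfold uu; rw [Finset.mul_sum]; exact Finset.sum_le_sum fun j _ => hle' _
  have gu : ∀ ω, uu B f n ω ≤ C₂ ^ 2 * ∑ j, ‖f j n ω‖ ^ 2 := fun ω => by
    unfold uu; rw [Finset.mul_sum]; exact Finset.sum_le_sum fun j _ => hge' _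
  have lA : ∀ ω, C₁ ^ 2 * ∑ j, ∑ l ∈ Finset.range n, ‖f j (l + 1) ω - f j l ω‖ ^ 2 ≤
      AA B f n ω := fun ω => by
    unfold AA; simp only [Finset.mul_sum]
    exact Finset.sum_le_sum fun j _ => Finset.sum_le_sum fun l _ => hle' _
  have gA : ∀ ω, AA B f n ω ≤
      C₂ ^ 2 * ∑ j, ∑ l ∈ Finset.range n, ‖f j (l + 1) ω - f j l ω‖ ^ 2 := fun ω => by
    unfold AA; simp only [Finset.mul_sum]
    exact Finset.sum_le_sum fun j _ => Finset.sum_le_sum fun l _ => hge' _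
  exact ⟨final_cmp hr hC₁ hC₂ nu nA lu gA (AA_nonneg h f n) (ii _ du) (ii _ dA) (ii _ du')
      (ii _ dA') k1,
    final_cmp hr hC₁ hC₂ nA nu lA gu (uu_nonneg h f n) (ii _ dA) (ii _ du) (ii _ dA')
      (ii _ du') k2⟩

end form

/-- The Rademacher functions. -/
noncomputable def rad (i : ℕ) (ω : ℝ) : ℝ := if Even ⌊(2:ℝ) ^ (i + 1) * ω⌋ then 1 else -1

lemma rad_dy (i : ℕ) : DyConst (i + 1) (rad i) := by
  intro ω ω' e
  simp only [rad, e]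

lemma rad_sq (i : ℕ) (ω : ℝ) : rad i ω ^ 2 = 1 := by
  unfold rad; split_ifs <;> norm_num

section rademacher
variable {X : Type*} [NormedAddCommGroup X] [NormedSpace ℝ X] [CompleteSpace X]

/-- Rademacher sums. -/
noncomputable def radSum (x : ℕ → X) (l : ℕ) (ω : ℝ) : X := ∑ i ∈ Finset.range l, rad i ω • x i

lemma radSum_dy (x : ℕ → X) (l : ℕ) : DyConst l (radSum x l) := by
  intro ω ω' e
  refine Finset.sum_congr rfl fun i hi => ?_
  rw [((rad_dy i).mono (m := l) (by simpa using hi)) ω ω' e]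

lemma radSum_mart (x : ℕ → X) :
    Martingale (radSum x) dyadicFiltration (volume.restrict (Set.Icc (0 : ℝ) 1)) := by
  refine martingale_of_avg (radSum_dy x) fun l k => ?_
  have e1 : radSum x l ((2 * (k:ℝ) + 1) / 2 ^ (l + 1)) = radSum x l ((k:ℝ) / 2 ^ l) :=
    radSum_dy x l _ _ (by rw [floor_pt, floor_pt'])
  have r1 : rad l ((k:ℝ) / 2 ^ l) = 1 := by
    have := floor_pt (l + 1) (2 * k)
    have h2 : (((2 * k : ℕ) : ℝ) / 2 ^ (l + 1)) = (k:ℝ) / 2 ^ l := by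
      push_cast; rw [pow_succ]; field_simp
    rw [h2] at this
    rw [rad, this, if_pos]; push_cast; exact even_two_mul _
  have r2 : rad l ((2 * (k:ℝ) + 1) / 2 ^ (l + 1)) = -1 := by
    have := floor_pt (l + 1) (2 * k + 1)
    push_cast at this
    rw [rad, this, if_neg]; rw [Int.not_even_iff_odd]; exact odd_two_mul_add_one _
  have s : ∀ ω, radSum x (l + 1) ω = radSum x l ω + rad l ω • x l := fun ω =>
    Finset.sum_range_succ _ _
  rw [s, s, e1, r1, r2, one_smul, neg_one_smul]
  rw [show radSum x l ((k:ℝ) / 2 ^ l) + x l + (radSum x l ((k:ℝ) / 2 ^ l) + -x l) = (2:ℝ) • radSum x l ((k:ℝ) / 2 ^ l) by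
    rw [two_smul]; abel, smul_smul]
  norm_num

/-- Discrete two-sided Rademacher inequality. -/
def RadIneq (X : Type*) [NormedAddCommGroup X] [NormedSpace ℝ X] (C : ℝ) : Prop :=
  ∀ n : ℕ, ∃ N : ℕ, 0 < N ∧ ∃ ε : ℕ → Fin n → ℝ, (∀ k i, ε k i ^ 2 = 1) ∧ ∀ x : Fin n → X,
    (N : ℝ)⁻¹ * ∑ k ∈ Finset.range N, ‖∑ i, ε k i • x i‖ ^ 2 ≤ C * ∑ i, ‖x i‖ ^ 2 ∧
    ∑ i, ‖x i‖ ^ 2 ≤ C * ((N : ℝ)⁻¹ * ∑ k ∈ Finset.range N, ‖∑ i, ε k i • x i‖ ^ 2)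

lemma radIneq_of {K : ℝ} (hK : 0 < K)
    (H : ∀ (M : ℕ), 1 ≤ M → ∀ f : Fin M → ℕ → ℝ → X,
      (∀ j, Martingale (f j) dyadicFiltration (volume.restrict (Set.Icc (0 : ℝ) 1))) →
      (∀ j, f j 0 = 0) →
      ∀ n : ℕ, 1 ≤ n → ∀ r : ℝ, 2 ≤ r →
        ((∫ ω, (∑ j, ‖f j n ω‖ ^ 2) ^ (r / 2)
            ∂(volume.restrict (Set.Icc (0 : ℝ) 1))) ^ (1 / r)
          ≤ K * r ^ (1 / (2 : ℝ)) *
            (∫ ω, (∑ j, ∑ l ∈ Finset.range n, ‖f j (l + 1) ω - f j l ω‖ ^ 2) ^ (r / 2)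
              ∂(volume.restrict (Set.Icc (0 : ℝ) 1))) ^ (1 / r)) ∧
        ((∫ ω, (∑ j, ∑ l ∈ Finset.range n, ‖f j (l + 1) ω - f j l ω‖ ^ 2) ^ (r / 2)
            ∂(volume.restrict (Set.Icc (0 : ℝ) 1))) ^ (1 / r)
          ≤ K * r ^ (1 / (2 : ℝ)) *
            (∫ ω, (∑ j, ‖f j n ω‖ ^ 2) ^ (r / 2)
              ∂(volume.restrict (Set.Icc (0 : ℝ) 1))) ^ (1 / r))) :
    RadIneq X (2 * K ^ 2) := by
  intro n
  rcases Nat.eq_zero_or_pos n with rfl | hn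
  · exact ⟨1, one_pos, fun _ _ => 1, by simp, fun x => by simp⟩
  refine ⟨2 ^ n, by positivity, fun k i => rad i ((k:ℝ) / 2 ^ n), fun _ _ => rad_sq _ _, fun x => ?_⟩
  set y : ℕ → X := fun i => if h : i < n then x ⟨i, h⟩ else 0 with hy
  have hyx : ∀ i : Fin n, y i = x i := fun i => by simp [hy]
  have hsum : ∀ ω, ∑ i : Fin n, rad i ω • x i = radSum y n ω := fun ω => by
    rw [radSum, Finset.sum_range]
    simp only [hyx]
  have hA : ∀ ω, (∑ j : Fin 1, ∑ l ∈ Finset.range n, ‖radSum y (l + 1) ω - radSum y l ω‖ ^ 2)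
      = ∑ i, ‖x i‖ ^ 2 := fun ω => by
    rw [Fin.sum_univ_one, Finset.sum_range]
    refine Finset.sum_congr rfl fun i _ => ?_
    rw [radSum, radSum, Finset.sum_range_succ, add_sub_cancel_left, norm_smul, mul_pow,
      Real.norm_eq_abs, sq_abs, rad_sq, one_mul, hyx]
  have h := H 1 le_rfl (fun _ => radSum y) (fun _ => radSum_mart y)
    (fun _ => by funext ω; simp [radSum]) n hn 2 le_rfl
  simp only [hA] at h
  have hd : DyConst n (fun ω => ‖radSum y n ω‖ ^ 2) := fun ω ω' e => by
    simp only [radSum_dy y n ω ω' e]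
  have hI := (dy_integral hd).2
  simp only [Fin.sum_univ_one, div_self (two_ne_zero : (2:ℝ) ≠ 0), Real.rpow_one, hI] at h
  have h1 : ∫ ω in Set.Icc (0:ℝ) 1, ∑ i, ‖x i‖ ^ 2 = ∑ i, ‖x i‖ ^ 2 := by
    simp
  rw [h1] at h
  simp only [hsum]
  push_cast
  simp only [smul_eq_mul, ← Real.sqrt_eq_rpow] at h
  set S := ∑ i, ‖x i‖ ^ 2
  set T := ((2:ℝ) ^ n)⁻¹ * ∑ k ∈ Finset.range (2 ^ n), ‖radSum y n ((k:ℝ) / 2 ^ n)‖ ^ 2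
  have hS : 0 ≤ S := by positivity
  have hT : 0 ≤ T := by positivity
  have key : ∀ a b : ℝ, 0 ≤ a → 0 ≤ b → √a ≤ K * √2 * √b → a ≤ 2 * K ^ 2 * b := by
    intro a b ha hb hab
    have := pow_le_pow_left₀ (Real.sqrt_nonneg a) hab 2
    rw [mul_pow, mul_pow, Real.sq_sqrt ha, Real.sq_sqrt hb, Real.sq_sqrt (by norm_num)] at this
    linarith
  exact ⟨key _ _ hT hS h.1, key _ _ hS hT h.2⟩

end rademacher

section gauss
open ProbabilityTheory
variable {X : Type*} [NormedAddCommGroup X] [NormedSpace ℝ X]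

/-- Standard Gaussian measure on `Fin n → ℝ`. -/
noncomputable def gam (n : ℕ) : Measure (Fin n → ℝ) := Measure.pi (fun _ => gaussianReal 0 1)

instance (n : ℕ) : IsProbabilityMeasure (gam n) := by unfold gam; infer_instance

/-- Gaussian second moment. -/
noncomputable def GG {n : ℕ} (x : Fin n → X) : ℝ := ∫ g, ‖∑ i, g i • x i‖ ^ 2 ∂(gam n)

lemma gam_eval {n : ℕ} (i : Fin n) : MeasurePreserving (fun g : Fin n → ℝ => g i) (gam n) (gaussianReal 0 1) :=
  measurePreserving_eval (μ := fun _ : Fin n => gaussianReal 0 1) i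

lemma gam_memLp {n : ℕ} (i : Fin n) : MemLp (fun g : Fin n → ℝ => g i) 2 (gam n) :=
  (memLp_id_gaussianReal' (μ := 0) (v := 1) 2 (by simp)).comp_measurePreserving (gam_eval i)

lemma gam_sq {n : ℕ} (i : Fin n) : ∫ g, g i ^ 2 ∂(gam n) = 1 := by
  have h2 : ∫ g, g i ^ 2 ∂(gam n) = ∫ t, t ^ 2 ∂(gaussianReal 0 1) := by
    rw [← (gam_eval i).map_eq, integral_map (gam_eval i).measurable.aemeasurable (by fun_prop)]
  rw [h2]
  have := variance_fun_id_gaussianReal (μ := 0) (v := 1)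
  rw [variance_eq_integral measurable_id'.aemeasurable] at this
  simpa [integral_id_gaussianReal] using this

lemma gam_int {n : ℕ} (x : Fin n → X) : Integrable (fun g : Fin n → ℝ => ‖∑ i, g i • x i‖ ^ 2) (gam n) := by
  have : MemLp (fun g : Fin n → ℝ => ∑ i, g i • x i) 2 (gam n) := by
    refine memLp_finsetSum _ fun i _ => ?_
    have hc : MemLp (fun _ : Fin n → ℝ => x i) ∞ (gam n) := memLp_top_const (x i)
    exact MemLp.smul (p := 2) (q := ∞) (r := 2) hc (gam_memLp i)
  exact this.norm.integrable_sq

lemma charFunDual_gam {F : Type*} [NormedAddCommGroup F] [NormedSpace ℝ F]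
    [MeasurableSpace F] [BorelSpace F] [SecondCountableTopology F] {n : ℕ} (x : Fin n → F) (L : StrongDual ℝ F) :
    charFunDual ((gam n).map (fun g => ∑ i, g i • x i)) L
      = Complex.exp (- ((∑ i, L (x i) ^ 2 : ℝ) : ℂ) / 2) := by
  rw [charFunDual_apply, integral_map (Measurable.aemeasurable (by fun_prop))
    (Measurable.aestronglyMeasurable (by fun_prop))]
  have e : ∀ g : Fin n → ℝ, Complex.exp ((L (∑ i, g i • x i) : ℝ) * Complex.I)
      = ∏ i, Complex.exp ((L (x i) : ℝ) * (g i : ℝ) * Complex.I) := by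
    intro g
    rw [← Complex.exp_sum, ← Finset.sum_mul]
    congr 2
    simp [mul_comm]
  simp_rw [e]
  rw [gam, integral_fintype_prod_eq_prod (f := fun i (t : ℝ) => Complex.exp ((L (x i) : ℝ) * (t : ℝ) * Complex.I))]
  simp_rw [← charFun_apply_real, charFun_gaussianReal, ← Complex.exp_sum]
  congr 1
  simp [Finset.sum_div, neg_div]

lemma GG_congr_findim {F : Type*} [NormedAddCommGroup F] [NormedSpace ℝ F] [FiniteDimensional ℝ F]
    {n : ℕ} (x y : Fin n → F) (h : ∀ φ : F →ₗ[ℝ] ℝ, ∑ i, φ (x i) ^ 2 = ∑ i, φ (y i) ^ 2) :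
    GG x = GG y := by
  let : MeasurableSpace F := borel F
  have : BorelSpace F := ⟨rfl⟩
  have : CompleteSpace F := FiniteDimensional.complete ℝ F
  have : ProperSpace F := FiniteDimensional.proper ℝ F
  have hm : (gam n).map (fun g => ∑ i, g i • x i) = (gam n).map (fun g => ∑ i, g i • y i) := by
    have : IsProbabilityMeasure ((gam n).map (fun g => ∑ i, g i • x i)) :=
      Measure.isProbabilityMeasure_map (Measurable.aemeasurable (by fun_prop))
    have : IsProbabilityMeasure ((gam n).map (fun g => ∑ i, g i • y i)) :=
      Measure.isProbabilityMeasure_map (Measurable.aemeasurable (by fun_prop))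
    refine Measure.ext_of_charFunDual ?_
    ext L
    rw [charFunDual_gam, charFunDual_gam]
    have := h L.toLinearMap
    simp only [ContinuousLinearMap.coe_coe] at this
    rw [this]
  have e : ∀ x : Fin n → F, GG x = ∫ v, ‖v‖ ^ 2 ∂((gam n).map (fun g => ∑ i, g i • x i)) := fun x => by
    rw [integral_map (Measurable.aemeasurable (by fun_prop))
      (Measurable.aestronglyMeasurable (by fun_prop))]
    rfl
  rw [e, e, hm]

lemma GG_congr {n : ℕ} (x y : Fin n → X)
    (h : ∀ φ : X →ₗ[ℝ] ℝ, ∑ i, φ (x i) ^ 2 = ∑ i, φ (y i) ^ 2) :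
    GG x = GG y := by
  let F : Submodule ℝ X := Submodule.span ℝ (Set.range x ∪ Set.range y)
  have : FiniteDimensional ℝ F :=
    FiniteDimensional.span_of_finite ℝ ((Set.finite_range x).union (Set.finite_range y))
  let x' : Fin n → F := fun i => ⟨x i, Submodule.subset_span (Or.inl ⟨i, rfl⟩)⟩
  let y' : Fin n → F := fun i => ⟨y i, Submodule.subset_span (Or.inr ⟨i, rfl⟩)⟩
  have := GG_congr_findim x' y' fun φ => by
    obtain ⟨ψ, hψ⟩ := LinearMap.exists_extend φ
    have e : ∀ v : F, φ v = ψ v := fun v => by rw [← hψ]; rfl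
    simp only [e]
    exact h ψ
  unfold GG at this ⊢
  have n1 : ∀ (z : Fin n → F) (g : Fin n → ℝ), ‖∑ i, g i • z i‖ = ‖∑ i, g i • (z i : X)‖ := fun z g => by
    rw [Submodule.coe_norm]; simp
  simpa only [n1] using this

lemma GG_bounds {C : ℝ} (H : RadIneq X C) {n : ℕ} (x : Fin n → X) :
    GG x ≤ C * ∑ i, ‖x i‖ ^ 2 ∧ ∑ i, ‖x i‖ ^ 2 ≤ C * GG x := by
  obtain ⟨N, hN, ε, hε, hx⟩ := H n
  have h1 : ∀ k, ∫ g, ‖∑ i, ε k i • g i • x i‖ ^ 2 ∂(gam n) = GG x := fun k => by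
    have : GG (fun i => ε k i • x i) = GG x := GG_congr _ _ fun φ => by
      simp [mul_pow, hε]
    rw [← this, GG]
    simp only [fun g : Fin n → ℝ => fun i => smul_comm (ε k i) (g i) (x i)]
  have hi : ∀ k, Integrable (fun g : Fin n → ℝ => ‖∑ i, ε k i • g i • x i‖ ^ 2) (gam n) := fun k => by
    have := gam_int (fun i => ε k i • x i)
    simpa only [fun g : Fin n → ℝ => fun i => smul_comm (ε k i) (g i) (x i)] using this
  have h2 : ∫ g : Fin n → ℝ, (N : ℝ)⁻¹ * ∑ k ∈ Finset.range N, ‖∑ i, ε k i • g i • x i‖ ^ 2 ∂(gam n) = GG x := by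
    rw [integral_const_mul, integral_finsetSum _ fun k _ => hi k]
    simp only [h1, Finset.sum_const, Finset.card_range, nsmul_eq_mul]
    field_simp
  have hi2 : Integrable (fun g : Fin n → ℝ => (N : ℝ)⁻¹ * ∑ k ∈ Finset.range N, ‖∑ i, ε k i • g i • x i‖ ^ 2) (gam n) :=
    (integrable_finsetSum _ fun k _ => hi k).const_mul _
  have hi4 : ∀ i, Integrable (fun g : Fin n → ℝ => ‖g i • x i‖ ^ 2) (gam n) := fun i => by
    simp only [norm_smul, mul_pow, Real.norm_eq_abs, sq_abs]
    exact (gam_memLp i).integrable_sq.mul_const _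
  have h3 : ∫ g : Fin n → ℝ, ∑ i, ‖g i • x i‖ ^ 2 ∂(gam n) = ∑ i, ‖x i‖ ^ 2 := by
    rw [integral_finsetSum _ fun i _ => hi4 i]
    refine Finset.sum_congr rfl fun i _ => ?_
    simp only [norm_smul, mul_pow, Real.norm_eq_abs, sq_abs]
    rw [integral_mul_const, gam_sq, one_mul]
  have hi3 : Integrable (fun g : Fin n → ℝ => ∑ i, ‖g i • x i‖ ^ 2) (gam n) :=
    integrable_finsetSum _ fun i _ => hi4 i
  constructor
  · rw [← h2, ← h3, ← integral_const_mul]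
    exact integral_mono hi2 (hi3.const_mul _) fun g => (hx fun i => g i • x i).1
  · rw [← h2, ← h3, ← integral_const_mul]
    exact integral_mono hi3 (hi2.const_mul _) fun g => (hx fun i => g i • x i).2

lemma kwapien_cmp {C : ℝ} (hC : 0 ≤ C) (H : RadIneq X C) {n : ℕ} (x y : Fin n → X)
    (h : ∀ φ : X →ₗ[ℝ] ℝ, ∑ i, φ (x i) ^ 2 = ∑ i, φ (y i) ^ 2) :
    ∑ i, ‖x i‖ ^ 2 ≤ C ^ 2 * ∑ i, ‖y i‖ ^ 2 := by
  have h1 := (GG_bounds H x).2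
  have h2 := (GG_bounds H y).1
  rw [GG_congr x y h] at h1
  nlinarith [mul_le_mul_of_nonneg_left h2 hC]

end gauss

section kwapien
variable {X : Type*} [NormedAddCommGroup X] [NormedSpace ℝ X]

/-- The sublinear functional. -/
noncomputable def theta (D : ℝ) (h : X →₀ ℝ) : ℝ := h.sum fun x a => max a (D * a) * ‖x‖ ^ 2

/-- The evaluation of a formal sum at the square of a functional. -/
noncomputable def hat (φ : X →ₗ[ℝ] ℝ) : (X →₀ ℝ) →ₗ[ℝ] ℝ :=
  Finsupp.linearCombination ℝ (fun x => φ x ^ 2)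

lemma hat_single (φ : X →ₗ[ℝ] ℝ) (x : X) (a : ℝ) : hat φ (Finsupp.single x a) = a * φ x ^ 2 := by
  simp [hat]

lemma theta_single {D : ℝ} (x : X) (a : ℝ) :
    theta D (Finsupp.single x a) = max a (D * a) * ‖x‖ ^ 2 := by
  simp [theta]

lemma theta_hom {D : ℝ} (c : ℝ) (hc : 0 < c) (h : X →₀ ℝ) : theta D (c • h) = c * theta D h := by
  unfold theta
  rw [Finsupp.sum_smul_index (fun i => by simp), Finsupp.sum, Finsupp.sum, Finset.mul_sum]
  refine Finset.sum_congr rfl fun x _ => ?_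
  rw [← mul_assoc c, mul_max_of_nonneg _ _ hc.le, mul_left_comm D c]

lemma theta_eq {D : ℝ} (h : X →₀ ℝ) {s : Finset X} (hs : h.support ⊆ s) :
    theta D h = ∑ x ∈ s, max (h x) (D * h x) * ‖x‖ ^ 2 :=
  Finsupp.sum_of_support_subset _ hs _ (by simp)

lemma theta_add {D : ℝ} (g h : X →₀ ℝ) : theta D (g + h) ≤ theta D g + theta D h := by
  classical
  rw [theta_eq (g + h) Finsupp.support_add, theta_eq g Finset.subset_union_left,
    theta_eq h Finset.subset_union_right, ← Finset.sum_add_distrib]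
  refine Finset.sum_le_sum fun x _ => ?_
  rw [← add_mul]
  refine mul_le_mul_of_nonneg_right ?_ (by positivity)
  rw [Finsupp.add_apply, mul_add]
  exact max_add_add_le_max_add_max

lemma theta_nonneg {C : ℝ} (hC : 0 ≤ C) (H : RadIneq X C) (h : X →₀ ℝ) (hh : ∀ φ, hat φ h = 0) :
    0 ≤ theta (max 1 (C ^ 2)) h := by
  let e := h.support.equivFin.symm
  have hs : ∀ F : X → ℝ, ∑ x ∈ h.support, F x = ∑ i, F (e i) := fun F => by
    rw [← Finset.sum_coe_sort, ← e.sum_comp]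
  let y : Fin h.support.card → X := fun i => √(max (h (e i)) 0) • (e i : X)
  let z : Fin h.support.card → X := fun i => √(max (-h (e i)) 0) • (e i : X)
  have hyz : ∀ φ : X →ₗ[ℝ] ℝ, ∑ i, φ (z i) ^ 2 = ∑ i, φ (y i) ^ 2 := fun φ => by
    have h1 := hh φ
    rw [hat, Finsupp.linearCombination_apply, Finsupp.sum, hs (fun x => h x • φ x ^ 2)] at h1
    rw [eq_comm, ← sub_eq_zero, ← Finset.sum_sub_distrib, ← h1]
    refine Finset.sum_congr rfl fun i _ => ?_
    simp only [y, z, map_smul, smul_eq_mul, mul_pow]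
    rw [Real.sq_sqrt (le_max_right _ _), Real.sq_sqrt (le_max_right _ _), ← sub_mul]
    congr 1
    rcases le_total 0 (h (e i)) with h0 | h0
    · rw [max_eq_left h0, max_eq_right (by linarith)]; ring
    · rw [max_eq_right h0, max_eq_left (by linarith)]; ring
  have k := kwapien_cmp hC H z y hyz
  have nz : ∀ i, ‖z i‖ ^ 2 = max (-h (e i)) 0 * ‖(e i : X)‖ ^ 2 := fun i => by
    simp only [z, norm_smul, mul_pow, Real.norm_eq_abs, sq_abs]
    rw [Real.sq_sqrt (le_max_right _ _)]
  have ny : ∀ i, ‖y i‖ ^ 2 = max (h (e i)) 0 * ‖(e i : X)‖ ^ 2 := fun i => by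
    simp only [y, norm_smul, mul_pow, Real.norm_eq_abs, sq_abs]
    rw [Real.sq_sqrt (le_max_right _ _)]
  set D := max 1 (C ^ 2) with hD
  have hD1 : 1 ≤ D := le_max_left _ _
  have k2 : ∑ i, ‖z i‖ ^ 2 ≤ D * ∑ i, ‖y i‖ ^ 2 :=
    k.trans (mul_le_mul_of_nonneg_right (le_max_right _ _) (by positivity))
  have : theta D h = D * ∑ i, ‖y i‖ ^ 2 - ∑ i, ‖z i‖ ^ 2 := by
    rw [theta, Finsupp.sum, hs (fun x => max (h x) (D * h x) * ‖x‖ ^ 2), Finset.mul_sum,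
      ← Finset.sum_sub_distrib]
    refine Finset.sum_congr rfl fun i _ => ?_
    rw [ny, nz, ← mul_assoc, ← sub_mul]
    congr 1
    rcases le_total 0 (h (e i)) with h0 | h0
    · rw [max_eq_left h0, max_eq_right (by linarith : -h (e i) ≤ 0), max_eq_right (by nlinarith)]; ring
    · rw [max_eq_right h0, max_eq_left (by linarith : 0 ≤ -h (e i)), max_eq_left (by nlinarith)]; ring
  rw [this]; linarith

lemma exists_Lambda {C : ℝ} (hC : 0 ≤ C) (H : RadIneq X C) :
    ∃ Λ : (X →₀ ℝ) →ₗ[ℝ] ℝ, (∀ g h, (∀ φ, hat φ g = hat φ h) → Λ g = Λ h) ∧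
      ∀ x, ‖x‖ ^ 2 ≤ Λ (Finsupp.single x 1) ∧
        Λ (Finsupp.single x 1) ≤ max 1 (C ^ 2) * ‖x‖ ^ 2 := by
  let Z : Submodule ℝ (X →₀ ℝ) := ⨅ φ : X →ₗ[ℝ] ℝ, LinearMap.ker (hat φ)
  have hZ : ∀ h, h ∈ Z ↔ ∀ φ, hat φ h = 0 := fun h => by simp [Z, Submodule.mem_iInf]
  let f : (X →₀ ℝ) →ₗ.[ℝ] ℝ := ⟨Z, 0⟩
  obtain ⟨Λ, h1, h2⟩ := exists_extension_of_le_sublinear f (theta (max 1 (C ^ 2)))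
    theta_hom theta_add fun x => theta_nonneg hC H x ((hZ x).1 x.2)
  refine ⟨Λ, fun g h hgh => ?_, fun x => ⟨?_, ?_⟩⟩
  · have hm : g - h ∈ Z := (hZ _).2 fun φ => by rw [map_sub, hgh, sub_self]
    have := h1 ⟨g - h, hm⟩
    have h3 : Λ (g - h) = 0 := this
    rw [map_sub] at h3; linarith
  · have := h2 (Finsupp.single x (-1))
    rw [theta_single, Finsupp.single_neg, map_neg,
      max_eq_left (by linarith [le_max_left 1 (C ^ 2)])] at this
    linarith
  · have := h2 (Finsupp.single x 1)
    rwa [theta_single, mul_one, max_eq_right (le_max_left 1 (C ^ 2))] at this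

lemma backward_core {C : ℝ} (hC : 0 ≤ C) (H : RadIneq X C) :
    ∃ c : InnerProductSpace.Core ℝ X, ∃ C₁ C₂ : ℝ, 0 < C₁ ∧ 0 < C₂ ∧
        ∀ x : X, C₁ * ‖x‖ ≤ Real.sqrt (c.inner x x) ∧ Real.sqrt (c.inner x x) ≤ C₂ * ‖x‖ := by
  obtain ⟨Λ, hΛ, hb⟩ := exists_Lambda hC H
  let B : X → X → ℝ := fun x y => (1 / 4) * Λ (Finsupp.single (x + y) 1 - Finsupp.single (x - y) 1)
  have hB : ∀ x y, B x y = Λ ((1 / 4 : ℝ) • (Finsupp.single (x + y) 1 - Finsupp.single (x - y) 1)) :=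
    fun x y => by rw [map_smul, smul_eq_mul]
  have hself : ∀ x, B x x = Λ (Finsupp.single x 1) := fun x => by
    rw [hB]
    refine hΛ _ _ fun φ => ?_
    simp only [map_smul, map_sub, hat_single, map_add, smul_eq_mul]; ring
  have hsymm : ∀ x y, B y x = B x y := fun x y => by
    rw [hB, hB]
    refine hΛ _ _ fun φ => ?_
    simp only [map_smul, map_sub, hat_single, map_add, smul_eq_mul]; ring
  have hadd : ∀ x y z, B (x + y) z = B x z + B y z := fun x y z => by
    rw [hB, hB, hB, ← map_add]
    refine hΛ _ _ fun φ => ?_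
    simp only [map_smul, map_sub, hat_single, map_add, smul_eq_mul]; ring
  have hsmul : ∀ x y (r : ℝ), B (r • x) y = r * B x y := fun x y r => by
    rw [hB, hB, ← smul_eq_mul, ← map_smul]
    refine hΛ _ _ fun φ => ?_
    simp only [map_smul, map_sub, hat_single, map_add, smul_eq_mul]; ring
  let c : InnerProductSpace.Core ℝ X :=
    { inner := B
      conj_inner_symm := fun x y => hsymm x y
      re_inner_nonneg := fun x => by
        change 0 ≤ B x x
        rw [hself]; exact le_trans (by positivity) (hb x).1
      add_left := hadd
      smul_left := fun x y r => hsmul x y r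
      definite := fun x hx => by
        change B x x = 0 at hx
        rw [hself] at hx
        have := (hb x).1
        rw [hx] at this
        have h0 : ‖x‖ = 0 := by nlinarith [norm_nonneg x, sq_nonneg ‖x‖]
        exact norm_eq_zero.1 h0 }
  have hD : (0:ℝ) < max 1 (C ^ 2) := lt_of_lt_of_le one_pos (le_max_left _ _)
  refine ⟨c, 1, √(max 1 (C ^ 2)), one_pos, Real.sqrt_pos.2 hD, fun x => ?_⟩
  change 1 * ‖x‖ ≤ √(B x x) ∧ √(B x x) ≤ √(max 1 (C ^ 2)) * ‖x‖
  rw [hself, one_mul]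
  refine ⟨Real.le_sqrt_of_sq_le (hb x).1, ?_⟩
  rw [← Real.sqrt_sq (norm_nonneg x), ← Real.sqrt_mul hD.le]
  exact Real.sqrt_le_sqrt (hb x).2

end kwapien
theorem isomorphic_to_hilbert_iff_double_dyadic_inequalities
    {X : Type*} [NormedAddCommGroup X] [NormedSpace ℝ X] [CompleteSpace X] :
    (∃ c : InnerProductSpace.Core ℝ X, ∃ C₁ C₂ : ℝ, 0 < C₁ ∧ 0 < C₂ ∧
        ∀ x : X, C₁ * ‖x‖ ≤ Real.sqrt (c.inner x x) ∧ Real.sqrt (c.inner x x) ≤ C₂ * ‖x‖) ↔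
    (∃ K : ℝ, 0 < K ∧ ∀ (M : ℕ), 1 ≤ M → ∀ f : Fin M → ℕ → ℝ → X,
      (∀ j, Martingale (f j) dyadicFiltration (volume.restrict (Set.Icc (0 : ℝ) 1))) →
      (∀ j, f j 0 = 0) →
      ∀ n : ℕ, 1 ≤ n → ∀ r : ℝ, 2 ≤ r →
        ((∫ ω, (∑ j, ‖f j n ω‖ ^ 2) ^ (r / 2)
            ∂(volume.restrict (Set.Icc (0 : ℝ) 1))) ^ (1 / r)
          ≤ K * r ^ (1 / (2 : ℝ)) *
            (∫ ω, (∑ j, ∑ l ∈ Finset.range n, ‖f j (l + 1) ω - f j l ω‖ ^ 2) ^ (r / 2)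
              ∂(volume.restrict (Set.Icc (0 : ℝ) 1))) ^ (1 / r)) ∧
        ((∫ ω, (∑ j, ∑ l ∈ Finset.range n, ‖f j (l + 1) ω - f j l ω‖ ^ 2) ^ (r / 2)
            ∂(volume.restrict (Set.Icc (0 : ℝ) 1))) ^ (1 / r)
          ≤ K * r ^ (1 / (2 : ℝ)) *
            (∫ ω, (∑ j, ‖f j n ω‖ ^ 2) ^ (r / 2)
              ∂(volume.restrict (Set.Icc (0 : ℝ) 1))) ^ (1 / r))) := by
  constructor
  · rintro ⟨c, C₁, C₂, hC₁, hC₂, hc⟩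
    have hB : IsForm c.inner :=
      { symm := fun x y => c.conj_inner_symm y x
        add := c.add_left
        smul := fun r x y => c.smul_left x y r
        nonneg := fun x => c.re_inner_nonneg x }
    refine ⟨C₂ / C₁ * 9, by positivity, fun M _ f hf h0 n _ r hr => ?_⟩
    exact forward_dir hB hC₁ hC₂ (fun x => (hc x).1) (fun x => (hc x).2) hf h0 n hr
  · rintro ⟨K, hK, H⟩
    exact backward_core (by positivity) (radIneq_of hK H)
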